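/- arXiv:2210.08104 — 7 statements merged into one kernel-verified Lean document; each statement's English description precedes it below -/
import Mathlib

section
/- Let u : ℝ^d → ℝ be l-periodic along every coordinate axis (u(x + l e_i) = u(x) for each standard basis vector e_i) and real-analytic on ℝ^d. Then there exist constants C, a > 0 such that for every natural number m, (l/(2π))^m · sqrt( E[ ∑_{α : |α| = m} |D^α u(X)|² ] ) ≤ C · a^m · m!, where X is uniformly distributed on [-l/2, l/2)^d; that is, u is (C,a)-semi-analytic. -/
open MeasureTheory

/-- The partial derivative `∂f/∂x_i` of a function `f : ℝ^d → ℝ`. -/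
noncomputable def pderiv {d : ℕ} (i : Fin d) (f : (Fin d → ℝ) → ℝ) :
    (Fin d → ℝ) → ℝ :=
  fun x => fderiv ℝ f x (Pi.single i 1)

/-- The multi-index partial derivative `D^α = ∂^{|α|}/∂x_1^{α_1} ⋯ ∂x_d^{α_d}`. -/
noncomputable def mderiv {d : ℕ} (α : Fin d → ℕ) (f : (Fin d → ℝ) → ℝ) :
    (Fin d → ℝ) → ℝ :=
  (List.finRange d).foldr (fun i g => (pderiv i)^[α i] g) f

open scoped NNReal ENNReal

section CauchyEstimates

variable {E F : Type*} [NormedAddCommGroup E] [NormedSpace ℝ E]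
  [NormedAddCommGroup F] [NormedSpace ℝ F]

/-- The coefficients of a re-expanded power series obey a geometric bound that is uniform in the
new centre. -/
lemma FormalMultilinearSeries.exists_nnnorm_changeOrigin_mul_pow_le
    (p : FormalMultilinearSeries ℝ E F) {r r' : ℝ≥0} (hr : (r + r' : ℝ≥0∞) < p.radius) :
    ∃ S : ℝ≥0, ∀ y : E, ‖y‖₊ ≤ r → ∀ k : ℕ, ‖p.changeOrigin y k‖₊ * r' ^ k ≤ S := by
  have hsum := (NNReal.summable_sigma.1 (p.changeOriginSeries_summable_aux₁ hr)).2
  have hr0 : (r : ℝ≥0∞) < p.radius := lt_of_le_of_lt le_self_add hr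
  refine ⟨_, fun y hy k => le_trans ?_ (hsum.le_tsum k fun _ _ => zero_le)⟩
  have hy' : (‖y‖₊ : ℝ≥0∞) < p.radius := lt_of_le_of_lt (by exact_mod_cast hy) hr0
  simp only [NNReal.tsum_mul_right]
  gcongr
  refine (p.nnnorm_changeOrigin_le k hy').trans ?_
  refine Summable.tsum_le_tsum (fun s => by gcongr) (p.changeOriginSeries_summable_aux₂ hy' k)
    (p.changeOriginSeries_summable_aux₂ hr0 k)

/-- The iterated derivatives are controlled by the power series coefficients. -/
lemma HasFPowerSeriesOnBall.norm_iteratedFDeriv_le {f : E → F}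
    {p : FormalMultilinearSeries ℝ E F} {x : E} {r : ℝ≥0∞} (h : HasFPowerSeriesOnBall f p x r)
    (h' : AnalyticOn ℝ f Set.univ) (n : ℕ) :
    ‖iteratedFDeriv ℝ n f x‖ ≤ n.factorial * ‖p n‖ := by
  refine ContinuousMultilinearMap.opNorm_le_bound (by positivity) fun v => ?_
  rw [h.iteratedFDeriv_eq_sum h']
  refine (norm_sum_le_of_le _ (n := fun _ => ‖p n‖ * ∏ i, ‖v i‖) fun σ _ => ?_).trans ?_
  · refine ((p n).le_opNorm _).trans_eq ?_
    rw [Equiv.prod_comp σ fun i => ‖v i‖]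
  · simp [Fintype.card_perm, mul_assoc]

/-- Cauchy estimates near a point, for a real-analytic function. -/
lemma exists_mem_nhds_norm_iteratedFDeriv_le [CompleteSpace F] {f : E → F} (hf : ∀ x, AnalyticAt ℝ f x) (x : E) :
    ∃ t ∈ nhds x, ∃ C a : ℝ, 0 < C ∧ 0 < a ∧
      ∀ y ∈ t, ∀ n : ℕ, ‖iteratedFDeriv ℝ n f y‖ ≤ C * a ^ n * n.factorial := by
  have hf' : AnalyticOn ℝ f Set.univ := fun y _ => (hf y).analyticWithinAt
  obtain ⟨p, R, hp⟩ := hf x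
  obtain ⟨ρ, hρ0, hρR⟩ := ENNReal.lt_iff_exists_nnreal_btwn.1 hp.r_pos
  have hρ : 0 < ρ := by exact_mod_cast hρ0
  have hhalf : ((ρ / 2 : ℝ≥0) : ℝ≥0∞) + ((ρ / 2 : ℝ≥0) : ℝ≥0∞) = ρ := by
    rw [← ENNReal.coe_add, add_halves]
  obtain ⟨S, hS⟩ := p.exists_nnnorm_changeOrigin_mul_pow_le (r := ρ / 2) (r' := ρ / 2)
    (by rw [hhalf]; exact hρR.trans_le hp.r_le)
  have hρ' : (0 : ℝ) < ρ / 2 := by positivity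
  refine ⟨Metric.closedBall x (ρ / 2), Metric.closedBall_mem_nhds x hρ', S + 1, (ρ / 2 : ℝ)⁻¹,
    by positivity, by positivity, fun y hy n => ?_⟩
  have hy1 : ‖y - x‖₊ ≤ ρ / 2 := by
    rw [← NNReal.coe_le_coe]
    simpa [dist_eq_norm] using hy
  have hyR : (‖y - x‖₊ : ℝ≥0∞) < R :=
    lt_of_le_of_lt (by exact_mod_cast hy1.trans (half_le_self hρ.le)) hρR
  have hps := hp.changeOrigin hyR
  rw [add_sub_cancel] at hps
  have hSn : ‖p.changeOrigin (y - x) n‖ * (ρ / 2 : ℝ) ^ n ≤ S := by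
    exact_mod_cast hS (y - x) hy1 n
  have hbound : ‖p.changeOrigin (y - x) n‖ ≤ (S + 1) * (ρ / 2 : ℝ)⁻¹ ^ n := by
    rw [inv_pow, ← div_eq_mul_inv, le_div_iff₀ (by positivity)]
    linarith
  calc ‖iteratedFDeriv ℝ n f y‖ ≤ n.factorial * ‖p.changeOrigin (y - x) n‖ :=
        hps.norm_iteratedFDeriv_le hf' n
    _ ≤ n.factorial * ((S + 1) * (ρ / 2 : ℝ)⁻¹ ^ n) := by gcongr
    _ = _ := by ring

/-- Cauchy estimates on a compact set, for a real-analytic function. -/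
lemma IsCompact.exists_norm_iteratedFDeriv_le [CompleteSpace F] {f : E → F} (hf : ∀ x, AnalyticAt ℝ f x)
    {K : Set E} (hK : IsCompact K) :
    ∃ C a : ℝ, 0 < C ∧ 0 < a ∧
      ∀ y ∈ K, ∀ n : ℕ, ‖iteratedFDeriv ℝ n f y‖ ≤ C * a ^ n * n.factorial := by
  refine hK.induction_on ?_ ?_ ?_ ?_
  · exact ⟨1, 1, one_pos, one_pos, by simp⟩
  · intro s t hst ht
    obtain ⟨C, a, hC, ha, h⟩ := ht
    exact ⟨C, a, hC, ha, fun y hy => h y (hst hy)⟩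
  · intro s t hs ht
    obtain ⟨C, a, hC, ha, h⟩ := hs
    obtain ⟨C', a', hC', ha', h'⟩ := ht
    refine ⟨max C C', max a a', lt_max_of_lt_left hC, lt_max_of_lt_left ha, fun y hy n => ?_⟩
    rcases hy with hy | hy
    · refine (h y hy n).trans ?_
      gcongr <;> exact le_max_left _ _
    · refine (h' y hy n).trans ?_
      gcongr <;> exact le_max_right _ _
  · rintro x -
    obtain ⟨t, ht, h⟩ := exists_mem_nhds_norm_iteratedFDeriv_le hf x
    exact ⟨t, mem_nhdsWithin_of_mem_nhds ht, h⟩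

end CauchyEstimates

section PartialDerivatives

variable {d : ℕ} {u : (Fin d → ℝ) → ℝ}

/-- `g` is the `n`-th derivative of `u` along a fixed family of directions of norm at most one. -/
def IsDirectionalDeriv (u : (Fin d → ℝ) → ℝ) (n : ℕ) (g : (Fin d → ℝ) → ℝ) : Prop :=
  ∃ v : Fin n → Fin d → ℝ, (∀ j, ‖v j‖ ≤ 1) ∧ g = fun x => iteratedFDeriv ℝ n u x v

lemma IsDirectionalDeriv.pderiv (hu : ContDiff ℝ ⊤ u) {n : ℕ} {g : (Fin d → ℝ) → ℝ}
    (hg : IsDirectionalDeriv u n g) (i : Fin d) : IsDirectionalDeriv u (n + 1) (pderiv i g) := by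
  obtain ⟨v, hv, rfl⟩ := hg
  refine ⟨Fin.cons (Pi.single i 1) v, fun j => ?_, ?_⟩
  · cases j using Fin.cases with
    | zero => simp [Pi.norm_single]
    | succ j => simpa using hv j
  · ext x
    have hdiff : DifferentiableAt ℝ (iteratedFDeriv ℝ n u) x :=
      hu.differentiable_iteratedFDeriv (by exact_mod_cast WithTop.coe_lt_top _) x
    rw [iteratedFDeriv_succ_apply_left, Fin.cons_zero, Fin.tail_cons, _root_.pderiv,
      fderiv_continuousMultilinear_apply_const_apply hdiff]

lemma IsDirectionalDeriv.iterate_pderiv (hu : ContDiff ℝ ⊤ u) {n : ℕ} {g : (Fin d → ℝ) → ℝ}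
    (hg : IsDirectionalDeriv u n g) (i : Fin d) (k : ℕ) :
    IsDirectionalDeriv u (n + k) ((_root_.pderiv i)^[k] g) := by
  induction k with
  | zero => exact hg
  | succ k ih =>
    rw [Function.iterate_succ_apply']
    exact ih.pderiv hu i

lemma isDirectionalDeriv_mderiv (hu : ContDiff ℝ ⊤ u) (α : Fin d → ℕ) :
    IsDirectionalDeriv u (∑ i, α i) (mderiv α u) := by
  have key (L : List (Fin d)) : IsDirectionalDeriv u (L.map α).sum
      (L.foldr (fun i g => (pderiv i)^[α i] g) u) := by
    induction L with
    | nil => exact ⟨Fin.elim0, fun j => j.elim0, by ext x; exact (iteratedFDeriv_zero_apply _).symm⟩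
    | cons i L ih =>
      rw [List.map_cons, List.sum_cons, add_comm, List.foldr_cons]
      exact ih.iterate_pderiv hu i (α i)
  have h := key (List.finRange d)
  rwa [← List.ofFn_eq_map, List.sum_ofFn] at h

lemma abs_mderiv_le (hu : ContDiff ℝ ⊤ u) (α : Fin d → ℕ) (x : Fin d → ℝ) :
    |mderiv α u x| ≤ ‖iteratedFDeriv ℝ (∑ i, α i) u x‖ := by
  obtain ⟨v, hv, h⟩ := isDirectionalDeriv_mderiv hu α
  rw [h, ← Real.norm_eq_abs]
  refine ((iteratedFDeriv ℝ _ u x).le_opNorm v).trans ?_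
  exact mul_le_of_le_one_right (norm_nonneg _)
    (Finset.prod_le_one (fun _ _ => norm_nonneg _) fun j _ => hv j)

end PartialDerivatives

lemma card_antidiagonalTuple_le (d m : ℕ) :
    (Finset.Nat.antidiagonalTuple d m).card ≤ (2 ^ d) ^ m := by
  have hsub : Finset.Nat.antidiagonalTuple d m ⊆
      Fintype.piFinset fun _ : Fin d => Finset.range (m + 1) := by
    intro α hα
    rw [Finset.Nat.mem_antidiagonalTuple] at hα
    refine Fintype.mem_piFinset.2 fun i => Finset.mem_range_succ_iff.2 ?_
    exact hα ▸ Finset.single_le_sum (fun _ _ => Nat.zero_le _) (Finset.mem_univ i)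
  calc (Finset.Nat.antidiagonalTuple d m).card ≤ (m + 1) ^ d := by
        simpa using Finset.card_le_card hsub
    _ ≤ (2 ^ m) ^ d := by gcongr; exact Nat.lt_two_pow_self
    _ = (2 ^ d) ^ m := by rw [← pow_mul, ← pow_mul, mul_comm]

/-- Every `l`-periodic real-analytic function `u : ℝ^d → ℝ` is
semi-analytic: there are `C, a > 0` such that for every `m`,
`(l/(2π))^m · sqrt(E[∑_{α : |α| = m} |D^α u(X)|²]) ≤ C · a^m · m!`, where
`X ~ Unif([-l/2, l/2)^d)`. -/
theorem analytic_periodic_implies_semianalytic {d : ℕ} (hd : 1 ≤ d)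
    (l : ℝ) (hl : 0 < l) (u : (Fin d → ℝ) → ℝ)
    (hper : ∀ (x : Fin d → ℝ) (i : Fin d), u (x + l • (Pi.single i 1 : Fin d → ℝ)) = u x)
    (hanal : ∀ x : Fin d → ℝ, AnalyticAt ℝ u x) :
    ∃ C a : ℝ, 0 < C ∧ 0 < a ∧ ∀ m : ℕ,
      (l / (2 * Real.pi)) ^ m *
        Real.sqrt ((1 / l ^ d) *
          ∫ x in Set.univ.pi (fun _ : Fin d => Set.Ico (-(l / 2)) (l / 2)),
            ∑ α ∈ Finset.Nat.antidiagonalTuple d m, (mderiv α u x) ^ 2)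
        ≤ C * a ^ m * Nat.factorial m := by
  have hu : ContDiff ℝ ⊤ u := contDiff_iff_contDiffAt.2 fun x => (hanal x).contDiffAt
  set Q : Set (Fin d → ℝ) := Set.univ.pi fun _ => Set.Ico (-(l / 2)) (l / 2) with hQ
  obtain ⟨C, a, hC, ha, hCa⟩ := IsCompact.exists_norm_iteratedFDeriv_le hanal
    (isCompact_univ_pi fun _ : Fin d => isCompact_Icc (a := -(l / 2)) (b := l / 2))
  refine ⟨C, l / (2 * Real.pi) * (2 ^ d * a), hC, by positivity, fun m => ?_⟩
  have hvol : volume.real Q = l ^ d := by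
    rw [Measure.real, hQ, Real.volume_pi_Ico_toReal fun _ => by linarith]
    simp
  have hfin : volume Q < ⊤ := by
    rw [hQ, Real.volume_pi_Ico]
    exact ENNReal.prod_lt_top fun _ _ => ENNReal.ofReal_lt_top
  set B : ℝ := C * a ^ m * m.factorial with hB
  have hB0 : 0 ≤ B := by positivity
  have hpoint : ∀ x ∈ Q, ‖∑ α ∈ Finset.Nat.antidiagonalTuple d m, (mderiv α u x) ^ 2‖
      ≤ (2 ^ d) ^ m * B ^ 2 := by
    intro x hx
    have hα : ∀ α ∈ Finset.Nat.antidiagonalTuple d m, (mderiv α u x) ^ 2 ≤ B ^ 2 := by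
      intro α hα
      rw [Finset.Nat.mem_antidiagonalTuple] at hα
      refine sq_le_sq' (neg_le_of_abs_le ?_) (le_of_abs_le ?_) <;>
      · refine (abs_mderiv_le hu α x).trans ?_
        rw [hα]
        exact hCa x (fun i hi => Set.Ico_subset_Icc_self (hx i hi)) m
    rw [Real.norm_of_nonneg (Finset.sum_nonneg fun _ _ => sq_nonneg _)]
    refine (Finset.sum_le_card_nsmul _ _ _ hα).trans ?_
    rw [nsmul_eq_mul]
    gcongr
    exact_mod_cast card_antidiagonalTuple_le d m
  have hint := (le_abs_self _).trans (norm_setIntegral_le_of_norm_le_const hfin hpoint)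
  rw [hvol] at hint
  have hone : (1 : ℝ) ≤ (2 ^ d) ^ m := one_le_pow₀ (one_le_pow₀ one_le_two)
  have hsqrt : Real.sqrt ((1 / l ^ d) *
      ∫ x in Q, ∑ α ∈ Finset.Nat.antidiagonalTuple d m, (mderiv α u x) ^ 2)
      ≤ (2 ^ d) ^ m * B := by
    refine Real.sqrt_le_iff.2 ⟨by positivity, ?_⟩
    calc _ ≤ (1 / l ^ d) * ((2 ^ d) ^ m * B ^ 2 * l ^ d) := by gcongr
      _ = (2 ^ d) ^ m * B ^ 2 := by field_simp
      _ ≤ ((2 ^ d) ^ m) ^ 2 * B ^ 2 := by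
        gcongr
        exact le_self_pow₀ hone two_ne_zero
      _ = _ := by ring
  calc _ ≤ (l / (2 * Real.pi)) ^ m * ((2 ^ d) ^ m * B) := by gcongr
    _ = _ := by rw [hB, mul_pow, mul_pow]; ring
end

section
/- For every integer d ≥ 1 and every natural number m, the sum of α! over all multi-indices α = (α_1, …, α_d) of non-negative integers with α_1 + ⋯ + α_d = m satisfies ∑_{α : |α| = m} α! ≤ 3^{d-1} · m!. -/
/-- Splitting off the first coordinate in a sum over `Finset.Nat.antidiagonalTuple`. -/
theorem sum_antidiagonalTuple_succ {M : Type*} [AddCommMonoid M] (k n : ℕ)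
    (f : (Fin (k + 1) → ℕ) → M) :
    ∑ α ∈ Finset.Nat.antidiagonalTuple (k + 1) n, f α =
      ∑ p ∈ Finset.HasAntidiagonal.antidiagonal n, ∑ β ∈ Finset.Nat.antidiagonalTuple k p.2,
        f (Fin.cons p.1 β) := by
  rw [Finset.sum_sigma']
  refine Finset.sum_bij' (fun α _ => ⟨(α 0, ∑ i, Fin.tail α i), Fin.tail α⟩)
    (fun x _ => Fin.cons x.1.1 x.2) ?_ ?_ ?_ ?_ ?_
  · intro α hα
    simpa [Finset.Nat.mem_antidiagonalTuple, Fin.sum_univ_succ, Fin.tail] using hα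
  · rintro ⟨⟨a, b⟩, β⟩ h
    simp only [Finset.mem_sigma, Finset.HasAntidiagonal.mem_antidiagonal,
      Finset.Nat.mem_antidiagonalTuple] at h
    simp [Finset.Nat.mem_antidiagonalTuple, Fin.sum_univ_succ, h.1, h.2]
  · intro α _
    exact Fin.cons_self_tail α
  · rintro ⟨⟨a, b⟩, β⟩ h
    simp only [Finset.mem_sigma, Finset.Nat.mem_antidiagonalTuple] at h
    simp [h.2]
  · intro α _
    exact congrArg f (Fin.cons_self_tail α).symm

theorem two_mul_sum_antidiagonal_factorial_succ (m : ℕ) :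
    2 * ∑ p ∈ Finset.HasAntidiagonal.antidiagonal (m + 1), p.1.factorial * p.2.factorial =
      (m + 2) * ∑ p ∈ Finset.HasAntidiagonal.antidiagonal m, p.1.factorial * p.2.factorial +
        2 * (m + 1).factorial := by
  have hsum : (m + 2) * ∑ p ∈ Finset.HasAntidiagonal.antidiagonal m, p.1.factorial * p.2.factorial =
      ∑ p ∈ Finset.HasAntidiagonal.antidiagonal m, (p.1 + 1).factorial * p.2.factorial +
        ∑ p ∈ Finset.HasAntidiagonal.antidiagonal m, p.1.factorial * (p.2 + 1).factorial := by
    rw [Finset.mul_sum, ← Finset.sum_add_distrib]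
    refine Finset.sum_congr rfl fun p hp => ?_
    rw [← Finset.HasAntidiagonal.mem_antidiagonal.1 hp, Nat.factorial_succ, Nat.factorial_succ]
    ring
  have hleft := Finset.Nat.sum_antidiagonal_succ (n := m)
    (f := fun p : ℕ × ℕ => p.1.factorial * p.2.factorial)
  have hright := Finset.Nat.sum_antidiagonal_succ' (n := m)
    (f := fun p : ℕ × ℕ => p.1.factorial * p.2.factorial)
  simp only [Nat.factorial_zero, one_mul, mul_one] at hleft hright
  linarith

theorem sum_antidiagonal_factorial_le (m : ℕ) :
    ∑ p ∈ Finset.HasAntidiagonal.antidiagonal m, p.1.factorial * p.2.factorial ≤ 3 * m.factorial := by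
  induction m with
  | zero => decide
  | succ m ih =>
    rcases Nat.lt_or_ge m 2 with hm | hm
    · interval_cases m <;> decide
    · have hrec := two_mul_sum_antidiagonal_factorial_succ m
      have hfac := Nat.factorial_succ m
      have hmul := Nat.mul_le_mul_left (m + 2) ih
      have hstep := Nat.mul_le_mul_right m.factorial hm
      nlinarith

/-- For every `d ≥ 1` and every `m`, the sum of `α!` over all
multi-indices `α = (α_1, …, α_d)` with `|α| = α_1 + ⋯ + α_d = m` satisfies
`∑_{α : |α| = m} α! ≤ 3^(d-1) · m!`. -/
theorem sum_factorial_multiindex_le (d m : ℕ) (hd : 1 ≤ d) :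
    ∑ α ∈ Finset.Nat.antidiagonalTuple d m, ∏ i, Nat.factorial (α i)
      ≤ 3 ^ (d - 1) * Nat.factorial m := by
  induction d, hd using Nat.le_induction generalizing m with
  | base => simp
  | succ k hk ih =>
    obtain ⟨k, rfl⟩ := Nat.exists_eq_add_of_le' hk
    rw [sum_antidiagonalTuple_succ]
    simp only [Fin.prod_univ_succ (n := k + 1), Fin.cons_zero, Fin.cons_succ,
      ← Finset.mul_sum, Nat.add_sub_cancel] at ih ⊢
    calc ∑ p ∈ Finset.HasAntidiagonal.antidiagonal m, p.1.factorial *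
          ∑ β ∈ Finset.Nat.antidiagonalTuple (k + 1) p.2, ∏ i, (β i).factorial
        ≤ ∑ p ∈ Finset.HasAntidiagonal.antidiagonal m, p.1.factorial * (3 ^ k * p.2.factorial) :=
          Finset.sum_le_sum fun p _ => Nat.mul_le_mul_left _ (ih p.2)
      _ = 3 ^ k * ∑ p ∈ Finset.HasAntidiagonal.antidiagonal m, p.1.factorial * p.2.factorial := by
          rw [Finset.mul_sum]
          exact Finset.sum_congr rfl fun p _ => by ring
      _ ≤ 3 ^ k * (3 * m.factorial) :=
          Nat.mul_le_mul_left _ (sum_antidiagonal_factorial_le m)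
      _ = 3 ^ (k + 1) * m.factorial := by ring
end

section
/- Let c : ℤ^d → ℂ be (C,a)-semi-analytic in coefficient form, and let N be an integer with N ≥ 2a. Then sqrt( ∑_{k ∈ ℤ^d, ‖k‖₂ ≥ N} |c[k]|² ) ≤ 2 e³ · C · exp( -(N/a)·(1 - 1/(2e)) ). -/
/-- Euclidean norm of an integer vector `k ∈ ℤ^d`. -/
noncomputable def znorm {d : ℕ} (k : Fin d → ℤ) : ℝ :=
  Real.sqrt (∑ i, ((k i : ℝ)) ^ 2)

/-- A weak Stirling upper bound, `m! ≤ e m (m / e) ^ m`, for `m = n + 1`. -/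
theorem factorial_succ_mul_exp_le (n : ℕ) :
    ((n + 1).factorial : ℝ) * Real.exp (n + 1) ≤ Real.exp 1 * ((n : ℝ) + 1) ^ (n + 2) := by
  induction n with
  | zero => simp
  | succ n ih =>
    have hbase : ((n : ℝ) + 1) / (n + 2) ≤ Real.exp (-(1 / ((n : ℝ) + 2))) := by
      have h := Real.add_one_le_exp (-(1 / ((n : ℝ) + 2)))
      have he : -(1 / ((n : ℝ) + 2)) + 1 = ((n : ℝ) + 1) / (n + 2) := by
        field_simp
        ring
      rwa [he] at h
    have hpow : (((n : ℝ) + 1) / (n + 2)) ^ (n + 2) ≤ Real.exp (-1) := by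
      refine (pow_le_pow_left₀ (by positivity) hbase _).trans_eq ?_
      rw [← Real.exp_nat_mul]
      congr 1
      push_cast
      field_simp
    have hratio : ((n : ℝ) + 1) ^ (n + 2) * Real.exp 1 ≤ ((n : ℝ) + 2) ^ (n + 2) := by
      rw [div_pow, div_le_iff₀ (by positivity), Real.exp_neg, inv_mul_eq_div,
        le_div_iff₀ (Real.exp_pos 1)] at hpow
      exact hpow
    rw [Nat.factorial_succ]
    push_cast
    calc ((n : ℝ) + 1 + 1) * ((n + 1).factorial : ℝ) * Real.exp ((n : ℝ) + 1 + 1)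
        = ((n : ℝ) + 2) * (((n + 1).factorial : ℝ) * Real.exp (n + 1)) * Real.exp 1 := by
          rw [Real.exp_add ((n : ℝ) + 1) 1]
          ring
      _ ≤ ((n : ℝ) + 2) * (Real.exp 1 * ((n : ℝ) + 1) ^ (n + 2)) * Real.exp 1 := by gcongr
      _ = ((n : ℝ) + 2) * Real.exp 1 * (((n : ℝ) + 1) ^ (n + 2) * Real.exp 1) := by ring
      _ ≤ ((n : ℝ) + 2) * Real.exp 1 * ((n : ℝ) + 2) ^ (n + 2) := by gcongr
      _ = Real.exp 1 * ((n : ℝ) + 1 + 1) ^ (n + 1 + 2) := by ring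

/-- Taking `m = ⌊x⌋`, the quantity `m! / x ^ m` is at most `e² x e⁻ˣ`. -/
theorem factorial_floor_le {x : ℝ} (hx : 1 ≤ x) :
    ((⌊x⌋₊.factorial : ℕ) : ℝ) ≤ Real.exp 2 * x * Real.exp (-x) * x ^ ⌊x⌋₊ := by
  have hfloor : 1 ≤ ⌊x⌋₊ := by simpa using hx
  obtain ⟨n, hn⟩ : ∃ n, ⌊x⌋₊ = n + 1 := ⟨⌊x⌋₊ - 1, by omega⟩
  have hle : (n : ℝ) + 1 ≤ x := by
    have := Nat.floor_le (zero_le_one.trans hx)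
    rw [hn] at this
    exact_mod_cast this
  have hlt : x < (n : ℝ) + 1 + 1 := by
    have := Nat.lt_floor_add_one x
    rw [hn] at this
    exact_mod_cast this
  have hx0 : 0 < x := by linarith
  rw [hn]
  calc ((n + 1).factorial : ℝ)
      = ((n + 1).factorial * Real.exp (n + 1)) * Real.exp (-((n : ℝ) + 1)) := by
        rw [mul_assoc, ← Real.exp_add, add_neg_cancel, Real.exp_zero, mul_one]
    _ ≤ (Real.exp 1 * ((n : ℝ) + 1) ^ (n + 2)) * Real.exp (1 - x) := by
        refine mul_le_mul (factorial_succ_mul_exp_le n) (Real.exp_le_exp.2 (by linarith))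
          (by positivity) (by positivity)
    _ ≤ (Real.exp 1 * x ^ (n + 2)) * Real.exp (1 - x) := by gcongr
    _ = Real.exp 2 * x * Real.exp (-x) * x ^ (n + 1) := by
        rw [show (2 : ℝ) = 1 + 1 by norm_num, Real.exp_add, sub_eq_add_neg, Real.exp_add]
        ring

/-- Markov-type inequality: a weighted square sum controls the tail where the weight is large. -/
theorem pow_mul_sqrt_tail_le {ι E : Type*} [NormedAddCommGroup E] (w : ι → ℝ) (c : ι → E)
    (m : ℕ) {R : ℝ} (hR : 0 < R)
    (hs : Summable fun k => w k ^ (2 * m) * ‖c k‖ ^ 2) :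
    R ^ m * Real.sqrt (∑' k : {k // R ≤ w k}, ‖c k‖ ^ 2) ≤
      Real.sqrt (∑' k, w k ^ (2 * m) * ‖c k‖ ^ 2) := by
  have hsub : Summable fun k : {k // R ≤ w k} => w k ^ (2 * m) * ‖c k‖ ^ 2 :=
    hs.subtype {k | R ≤ w k}
  have hle : ∀ k : {k // R ≤ w k}, R ^ (2 * m) * ‖c k‖ ^ 2 ≤ w k ^ (2 * m) * ‖c k‖ ^ 2 := by
    intro k
    have := k.2
    gcongr
  have hs' : Summable fun k : {k // R ≤ w k} => R ^ (2 * m) * ‖c k‖ ^ 2 :=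
    Summable.of_nonneg_of_le (fun k => by positivity) hle hsub
  have hnonneg : ∀ k, 0 ≤ w k ^ (2 * m) * ‖c k‖ ^ 2 := fun k => by
    rw [pow_mul]
    positivity
  have hmain : R ^ (2 * m) * ∑' k : {k // R ≤ w k}, ‖c k‖ ^ 2 ≤
      ∑' k, w k ^ (2 * m) * ‖c k‖ ^ 2 := by
    rw [← tsum_mul_left]
    exact (hs'.tsum_le_tsum hle hsub).trans (hs.tsum_subtype_le _ {k | R ≤ w k} hnonneg)
  calc R ^ m * Real.sqrt (∑' k : {k // R ≤ w k}, ‖c k‖ ^ 2)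
      = Real.sqrt (R ^ (2 * m) * ∑' k : {k // R ≤ w k}, ‖c k‖ ^ 2) := by
        rw [Real.sqrt_mul (by positivity), mul_comm 2 m, pow_mul, Real.sqrt_sq (by positivity)]
    _ ≤ _ := Real.sqrt_le_sqrt hmain

/-- If `c : ℤ^d → ℂ` is `(C,a)`-semi-analytic in coefficient form,
i.e. `sqrt(∑_k ‖k‖₂^(2m) |c k|²) ≤ C a^m m!` for every `m`, and `N` is an integer with
`N ≥ 2a`, then `sqrt(∑_{‖k‖₂ ≥ N} |c k|²) ≤ 2 e³ C exp(-(N/a)(1 - 1/(2e)))`. -/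
theorem semianalytic_fourier_tail {d : ℕ} (c : (Fin d → ℤ) → ℂ) (C a : ℝ)
    (hC : 0 < C) (ha : 0 < a)
    (hsummable : ∀ m : ℕ, Summable fun k : Fin d → ℤ => znorm k ^ (2 * m) * ‖c k‖ ^ 2)
    (hsa : ∀ m : ℕ,
      Real.sqrt (∑' k : Fin d → ℤ, znorm k ^ (2 * m) * ‖c k‖ ^ 2)
        ≤ C * a ^ m * Nat.factorial m)
    (N : ℕ) (hN : 2 * a ≤ (N : ℝ)) :
    Real.sqrt (∑' k : {k : Fin d → ℤ // (N : ℝ) ≤ znorm k}, ‖c (k : Fin d → ℤ)‖ ^ 2)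
      ≤ 2 * Real.exp 3 * C * Real.exp (-((N : ℝ) / a) * (1 - 1 / (2 * Real.exp 1))) := by
  have hNpos : (0 : ℝ) < N := by linarith
  set x : ℝ := (N : ℝ) / a with hxdef
  have hx : 2 ≤ x := by rwa [hxdef, le_div_iff₀ ha]
  have hNx : (N : ℝ) = a * x := by rw [hxdef, mul_div_cancel₀ _ ha.ne']
  have hxpos : 0 < x := by linarith
  have htail := (pow_mul_sqrt_tail_le znorm c ⌊x⌋₊ hNpos (hsummable _)).trans (hsa ⌊x⌋₊)
  set T := Real.sqrt (∑' k : {k : Fin d → ℤ // (N : ℝ) ≤ znorm k}, ‖c (k : Fin d → ℤ)‖ ^ 2)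
  have hT : T ≤ C * (Real.exp 2 * x * Real.exp (-x)) := by
    have hpow : 0 < (N : ℝ) ^ ⌊x⌋₊ := by positivity
    refine le_of_mul_le_mul_left (htail.trans ?_) hpow
    calc C * a ^ ⌊x⌋₊ * (⌊x⌋₊.factorial : ℝ)
        ≤ C * a ^ ⌊x⌋₊ * (Real.exp 2 * x * Real.exp (-x) * x ^ ⌊x⌋₊) := by
          gcongr
          exact factorial_floor_le (by linarith)
      _ = (N : ℝ) ^ ⌊x⌋₊ * (C * (Real.exp 2 * x * Real.exp (-x))) := by
          rw [hNx, mul_pow]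
          ring
  have hlin : x ≤ 2 * Real.exp 1 * Real.exp (x / (2 * Real.exp 1)) := by
    have h := Real.add_one_le_exp (x / (2 * Real.exp 1))
    rw [mul_comm, ← div_le_iff₀ (by positivity)]
    linarith
  calc T ≤ C * (Real.exp 2 * x * Real.exp (-x)) := hT
    _ ≤ C * (Real.exp 2 * (2 * Real.exp 1 * Real.exp (x / (2 * Real.exp 1))) *
          Real.exp (-x)) := by gcongr
    _ = 2 * Real.exp 3 * C * Real.exp (-x * (1 - 1 / (2 * Real.exp 1))) := by
        rw [show -x * (1 - 1 / (2 * Real.exp 1)) = x / (2 * Real.exp 1) + -x by ring,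
          Real.exp_add, show (3 : ℝ) = 2 + 1 by norm_num, Real.exp_add]
        ring
end

section
/- Let c : ℤ^d → ℂ be absolutely summable and let u : ℝ^d → ℂ be the function u(x) = ∑_{k ∈ ℤ^d} c[k] · exp(i 2π ⟨k, x⟩ / l) for some l > 0. Then for every integer N ≥ 1 and every k ∈ [-N..N]^d, the centered discrete Fourier transform of the samples of u satisfies the aliasing identity: (2N+1)^{-d} · ∑_{n ∈ [-N..N]^d} u( l n / (2N+1) ) · exp( -i 2π ⟨k, n⟩ / (2N+1) ) = ∑_{p ∈ ℤ^d} c[ k + (2N+1) p ]. -/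
/-- The symmetric geometric sum, multiplied by `z - 1`, telescopes. -/
lemma sub_one_mul_sum_zpow_Icc_neg {K : Type*} [Field K] {z : K} (hz : z ≠ 0) (N : ℕ) :
    (z - 1) * ∑ n ∈ Finset.Icc (-(N : ℤ)) N, z ^ n = z ^ ((N : ℤ) + 1) - z ^ (-(N : ℤ)) := by
  induction N with
  | zero => simp
  | succ N ih =>
    have hIcc : Finset.Icc (-((N + 1 : ℕ) : ℤ)) ((N + 1 : ℕ) : ℤ) =
        insert (-((N : ℤ) + 1)) (insert ((N : ℤ) + 1) (Finset.Icc (-(N : ℤ)) N)) := by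
      ext x
      simp only [Finset.mem_insert, Finset.mem_Icc]
      omega
    rw [hIcc, Finset.sum_insert (by simp; omega), Finset.sum_insert (by simp), mul_add, mul_add,
      ih]
    have hpos : z ^ (((N + 1 : ℕ) : ℤ) + 1) = z * z ^ ((N : ℤ) + 1) := by
      rw [← zpow_one_add₀ hz]; push_cast; ring_nf
    have hneg : z ^ (-(N : ℤ)) = z * z ^ (-((N : ℤ) + 1)) := by
      rw [← zpow_one_add₀ hz]; ring_nf
    rw [hpos, hneg]
    push_cast
    ring

open Complex in
/-- Orthogonality of the characters `n ↦ exp (2πi a n / (2N+1))` on the centered window. -/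
lemma sum_Icc_neg_exp_two_pi_mul_I (N : ℕ) (a : ℤ) :
    ∑ n ∈ Finset.Icc (-(N : ℤ)) N, exp (2 * Real.pi * I * (a * n / (2 * N + 1))) =
      if (2 * (N : ℤ) + 1) ∣ a then 2 * (N : ℂ) + 1 else 0 := by
  have hζ : IsPrimitiveRoot (exp (2 * Real.pi * I / ((2 * N + 1 : ℕ) : ℂ))) (2 * N + 1) :=
    Complex.isPrimitiveRoot_exp _ (by omega)
  set ζ := exp (2 * Real.pi * I / ((2 * N + 1 : ℕ) : ℂ)) with hζ_def
  have hζ0 : ζ ≠ 0 := exp_ne_zero _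
  have hterm : ∀ n : ℤ, exp (2 * Real.pi * I * (a * n / (2 * N + 1))) = (ζ ^ a) ^ n := by
    intro n
    rw [← zpow_mul, hζ_def, ← exp_int_mul]
    congr 1
    push_cast
    ring
  have hdvd : ζ ^ a = 1 ↔ (2 * (N : ℤ) + 1) ∣ a := by
    simpa using hζ.zpow_eq_one_iff_dvd a
  simp only [hterm]
  split_ifs with h
  · simp only [hdvd.2 h, one_zpow, Finset.sum_const, Int.card_Icc, nsmul_eq_mul, mul_one]
    have hcard : ((N : ℤ) + 1 - -(N : ℤ)).toNat = 2 * N + 1 := by omega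
    rw [hcard]
    push_cast
    ring
  · have hne : ζ ^ a - 1 ≠ 0 := sub_ne_zero.2 (mt hdvd.1 h)
    have hz0 : ζ ^ a ≠ 0 := zpow_ne_zero _ hζ0
    refine (mul_eq_zero.1 ?_).resolve_left hne
    rw [sub_one_mul_sum_zpow_Icc_neg hz0, sub_eq_zero]
    have hperiod : (ζ ^ a) ^ (2 * (N : ℤ) + 1) = 1 := by
      rw [← zpow_mul, mul_comm, zpow_mul]
      have : ζ ^ (2 * (N : ℤ) + 1) = 1 := by exact_mod_cast hζ.pow_eq_one
      rw [this, one_zpow]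
    rw [show (N : ℤ) + 1 = (2 * (N : ℤ) + 1) + -(N : ℤ) by ring, zpow_add₀ hz0, hperiod, one_mul]

open Complex in
/-- Orthogonality of the characters of `ℤ^d` on the centered cube. -/
lemma sum_piFinset_Icc_neg_exp {d : ℕ} (N : ℕ) (a : Fin d → ℤ) :
    ∑ n ∈ Fintype.piFinset (fun _ : Fin d => Finset.Icc (-(N : ℤ)) N),
        exp (2 * Real.pi * I * ∑ i, ((a i : ℂ) * n i / (2 * N + 1))) =
      if ∀ i, (2 * (N : ℤ) + 1) ∣ a i then (2 * (N : ℂ) + 1) ^ d else 0 := by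
  simp only [Finset.mul_sum, exp_sum]
  rw [← Finset.prod_univ_sum (fun _ : Fin d => Finset.Icc (-(N : ℤ)) N)
    (fun i n => exp (2 * Real.pi * I * ((a i : ℂ) * n / (2 * N + 1))))]
  simp only [sum_Icc_neg_exp_two_pi_mul_I]
  rw [Finset.prod_ite_zero]
  simp

/-- **aliasing identity.** Let `c : ℤ^d → ℂ` be absolutely summable and
`u(x) = ∑_{k ∈ ℤ^d} c[k] exp(i 2π ⟨k,x⟩ / l)` for some `l > 0`. Then for every integer
`N ≥ 1` and every `k ∈ [-N..N]^d`, the centered discrete Fourier transform of the samples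
of `u` satisfies
`(2N+1)^{-d} ∑_{n ∈ [-N..N]^d} u(l n/(2N+1)) exp(-i 2π ⟨k,n⟩/(2N+1))
  = ∑_{p ∈ ℤ^d} c[k + (2N+1) p]`. -/
theorem dft_aliasing {d : ℕ} (c : (Fin d → ℤ) → ℂ)
    (hc : Summable fun k : Fin d → ℤ => ‖c k‖)
    (l : ℝ) (hl : 0 < l) (u : (Fin d → ℝ) → ℂ)
    (hu : ∀ x : Fin d → ℝ,
      u x = ∑' k : Fin d → ℤ,
        c k * Complex.exp (Complex.I * (2 * Real.pi * (∑ i, (k i : ℝ) * x i) / l)))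
    (N : ℕ) (hN : 1 ≤ N) (k : Fin d → ℤ) (hk : ∀ i, k i ∈ Finset.Icc (-(N : ℤ)) N) :
    (1 / (2 * (N : ℂ) + 1) ^ d) *
        ∑ n ∈ Fintype.piFinset (fun _ : Fin d => Finset.Icc (-(N : ℤ)) N),
          u (fun i => l * (n i : ℝ) / (2 * (N : ℝ) + 1)) *
            Complex.exp (-Complex.I *
              (2 * Real.pi * (∑ i, (k i : ℝ) * (n i : ℝ)) / (2 * (N : ℝ) + 1)))
      = ∑' p : Fin d → ℤ, c (fun i => k i + (2 * (N : ℤ) + 1) * p i) := by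
  have hM : (2 * (N : ℂ) + 1) ≠ 0 := by exact_mod_cast (by omega : 2 * N + 1 ≠ 0)
  have hlC : (l : ℂ) ≠ 0 := by exact_mod_cast hl.ne'
  let e : (Fin d → ℤ) → (Fin d → ℤ) → ℂ := fun m n =>
    Complex.exp (2 * Real.pi * Complex.I * ∑ i, (((m i - k i : ℤ) : ℂ) * n i / (2 * N + 1)))
  have hsample : ∀ n : Fin d → ℤ,
      u (fun i => l * (n i : ℝ) / (2 * (N : ℝ) + 1)) *
          Complex.exp (-Complex.I *
            (2 * Real.pi * (∑ i, (k i : ℝ) * (n i : ℝ)) / (2 * (N : ℝ) + 1))) =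
        ∑' m, c m * e m n := by
    intro n
    rw [hu, ← tsum_mul_right]
    refine tsum_congr fun m => ?_
    rw [mul_assoc, ← Complex.exp_add]
    congr 2
    push_cast
    simp only [Finset.mul_sum, Finset.sum_div, ← Finset.sum_add_distrib]
    refine Finset.sum_congr rfl fun i _ => ?_
    field_simp
    ring
  have hnorm : ∀ m n, ‖e m n‖ = 1 := by
    intro m n
    have harg : 2 * Real.pi * Complex.I * ∑ i, (((m i - k i : ℤ) : ℂ) * n i / (2 * N + 1)) =
        ((2 * Real.pi * ∑ i, (((m i - k i : ℤ) : ℝ) * n i / (2 * N + 1)) : ℝ) : ℂ) *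
          Complex.I := by
      push_cast
      ring
    simp only [e]
    rw [harg, Complex.norm_exp_ofReal_mul_I]
  have hsummable : ∀ n, Summable fun m => c m * e m n := fun n =>
    Summable.of_norm (by simpa [hnorm] using hc)
  simp only [hsample]
  rw [← Summable.tsum_finsetSum fun n _ => hsummable n, ← tsum_mul_left]
  have hcoeff : ∀ m : Fin d → ℤ,
      1 / (2 * (N : ℂ) + 1) ^ d *
          ∑ n ∈ Fintype.piFinset (fun _ : Fin d => Finset.Icc (-(N : ℤ)) N), c m * e m n =
        if ∀ i, (2 * (N : ℤ) + 1) ∣ m i - k i then c m else 0 := by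
    intro m
    rw [← Finset.mul_sum, sum_piFinset_Icc_neg_exp N fun i => m i - k i]
    split_ifs
    · field_simp
    · simp
  simp only [hcoeff]
  have hinj : Function.Injective
      fun (p : Fin d → ℤ) (i : Fin d) => k i + (2 * (N : ℤ) + 1) * p i := by
    intro p q hpq
    funext i
    exact mul_left_cancel₀ (by omega : 2 * (N : ℤ) + 1 ≠ 0) (add_left_cancel (congrFun hpq i))
  rw [← hinj.tsum_eq]
  · simp
  · intro m hm
    have hdvd : ∀ i, (2 * (N : ℤ) + 1) ∣ m i - k i := by
      by_contra h
      exact hm (if_neg h)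
    choose p hp using hdvd
    exact ⟨p, funext fun i => by simp only [← hp]; ring⟩
end

section
/- Let a ≥ 8, set z = 1 + 8/a, and let θ ∈ (0,1). Then the geometric weights w_k = z^{-|k|} on ℤ satisfy ∑_{k ∈ ℤ, |k| > θ a/16} z^{-|k|} > ( (1-θ)² / (512 e) ) · ∑_{k ∈ ℤ} z^{-|k|}. -/
/-- For `z > 1` the weights `z ^ (-|k|)` are summable over `ℤ`. -/
theorem summable_zpow_neg_abs {z : ℝ} (hz : 1 < z) : Summable fun k : ℤ => z ^ (-|k|) := by
  have h0 : 0 ≤ z⁻¹ := by positivity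
  have hgeom : Summable fun n : ℕ => z⁻¹ ^ n :=
    summable_geometric_of_lt_one h0 (inv_lt_one_of_one_lt₀ hz)
  refine Summable.of_nat_of_neg ?_ ?_ <;> simpa using hgeom

/-- Shifting `ℤ` away from the origin by `m` shows that the mass of the weights `z ^ (-|k|)` on any
set containing `{k | m ≤ |k|}` is at least `z ^ (-m)` times the total mass. -/
theorem zpow_neg_mul_tsum_le_tsum_tail {z : ℝ} (hz : 1 < z) (m : ℕ) {p : ℤ → Prop}
    (hp : ∀ k : ℤ, (m : ℤ) ≤ |k| → p k) :
    z ^ (-(m : ℤ)) * ∑' k : ℤ, z ^ (-|k|) ≤ ∑' k : {k : ℤ // p k}, z ^ (-|(k : ℤ)|) := by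
  have hz0 : 0 < z := by linarith
  have hs := summable_zpow_neg_abs hz
  let f : ℤ → ℤ := fun k => if 0 ≤ k then k + m else k - m
  have hf : ∀ k, |f k| = |k| + m := by
    intro k
    simp only [f]
    split_ifs <;> grind
  have hinj : Function.Injective f := by
    intro k l h
    simp only [f] at h
    split_ifs at h <;> omega
  let g : ℤ → {k : ℤ // p k} := fun k => ⟨f k, hp _ (by rw [hf]; linarith [abs_nonneg k])⟩
  have hg : Function.Injective g := fun k l h => hinj (congrArg Subtype.val h)
  rw [← tsum_mul_left]
  refine Summable.tsum_le_tsum_of_inj g hg (fun _ _ => by positivity) (fun k => ?_)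
    (hs.mul_left _) (hs.subtype {k | p k})
  simp only [g, hf]
  rw [← zpow_add₀ hz0.ne', ← neg_add, add_comm]

/-- For `a ≥ 8`, `z = 1 + 8/a` and `θ ∈ (0,1)`, the geometric
weights `w_k = z^{-|k|}` on `ℤ` satisfy
`∑_{|k| > θa/16} z^{-|k|} > ((1-θ)²/(512 e)) · ∑_{k ∈ ℤ} z^{-|k|}`. -/
theorem geometric_weights_tail_lower (a θ : ℝ) (ha : 8 ≤ a) (hθ : θ ∈ Set.Ioo (0 : ℝ) 1) :
    ((1 - θ) ^ 2 / (512 * Real.exp 1)) * ∑' k : ℤ, (1 + 8 / a) ^ (-|k|)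
      < ∑' k : {k : ℤ // θ * a / 16 < |k|}, (1 + 8 / a) ^ (-|(k : ℤ)|) := by
  obtain ⟨hθ0, hθ1⟩ := hθ
  have ha0 : 0 < a := by linarith
  have hz : 1 < 1 + 8 / a := lt_add_of_pos_right _ (by positivity)
  have hz0 : 0 < 1 + 8 / a := by positivity
  set m := ⌊θ * a / 16⌋₊ + 1 with hm
  have htail : ∀ k : ℤ, (m : ℤ) ≤ |k| → θ * a / 16 < |k| := by
    intro k hk
    have h1 : θ * a / 16 < (m : ℝ) := by
      rw [hm]; push_cast; exact Nat.lt_floor_add_one _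
    exact h1.trans_le (by exact_mod_cast hk)
  have hpos : 0 < ∑' k : ℤ, (1 + 8 / a) ^ (-|k|) :=
    (summable_zpow_neg_abs hz).tsum_pos (fun _ => by positivity) 0 (by positivity)
  refine lt_of_lt_of_le ?_ (zpow_neg_mul_tsum_le_tsum_tail hz m htail)
  refine mul_lt_mul_of_pos_right ?_ hpos
  have hm_le : (m : ℝ) ≤ a / 16 + 1 := by
    have h1 : (⌊θ * a / 16⌋₊ : ℝ) ≤ θ * a / 16 := Nat.floor_le (by positivity)
    rw [hm]; push_cast
    nlinarith
  have hexponent : (m : ℝ) * (8 / a) ≤ 2 := by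
    rw [mul_div_assoc', div_le_iff₀ ha0]
    linarith
  have hpow : (1 + 8 / a) ^ m ≤ Real.exp 1 * Real.exp 1 :=
    calc (1 + 8 / a) ^ m ≤ Real.exp (8 / a) ^ m := by
          gcongr
          linarith [Real.add_one_le_exp (8 / a)]
      _ = Real.exp (m * (8 / a)) := (Real.exp_nat_mul _ _).symm
      _ ≤ Real.exp (1 + 1) := Real.exp_le_exp.mpr (by linarith)
      _ = Real.exp 1 * Real.exp 1 := Real.exp_add 1 1
  have he : Real.exp 1 < 3 := by linarith [Real.exp_one_lt_d9]
  have he0 := Real.exp_pos 1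
  rw [zpow_neg, zpow_natCast, ← one_div, div_lt_div_iff₀ (by positivity) (by positivity)]
  have hsq : (1 - θ) ^ 2 ≤ 1 := by nlinarith
  have hle : (1 - θ) ^ 2 * (1 + 8 / a) ^ m ≤ 1 * (Real.exp 1 * Real.exp 1) := by gcongr
  nlinarith
end

section
/- Let N ≥ 1 be an integer, l > 0, and let u ∈ ℂ^{[-N..N]^d}. For j ∈ {1, …, d} define the Fourier derivative (∂̃_j u)[n] = ∑_{m=-N}^{N} u[n_1, …, n_{j-1}, m, n_{j+1}, …, n_d] · a[n_j − m], where a[0] = 0 and a[m] = π (-1)^{m+1} / ( l · sin( π m / (2N+1) ) ) for m ≠ 0 (indices taken modulo 2N+1 in [-N..N]). Then ‖∂̃_j u‖_∞ ≤ (2π/l) · ‖u‖_∞ · (2N+1) · [ (1/π) ln( (4N+2)/π ) + 1/2 ]. Moreover, if N > 3 then ‖∂̃_j u‖_∞ ≤ (48/l) · ‖u‖_∞ · N ln N. -/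
/-- The Fourier differentiation kernel `a[m]` for the centered grid `[-N..N]`:
`a[0] = 0` and `a[m] = π (-1)^{m+1} / (l sin(π m/(2N+1)))` for `m ≠ 0`, with the index
`m` reduced modulo `2N+1` to the representative in `[-N..N]`. -/
noncomputable def fourierKer (N : ℕ) (l : ℝ) (m : ℤ) : ℝ :=
  if ((m + N) % (2 * (N : ℤ) + 1) - N) = 0 then 0
  else Real.pi * (-1 : ℝ) ^ (((m + N) % (2 * (N : ℤ) + 1) - N) + 1) /
    (l * Real.sin (Real.pi * (((m + N) % (2 * (N : ℤ) + 1) - N : ℤ) : ℝ) /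
      (2 * (N : ℝ) + 1)))

/-- A lower bound for the increments of `x ↦ log (tan (x / 2))`, an antiderivative of
`x ↦ 1 / sin x`. -/
theorem sub_div_sin_le_log_tan_sub {a b : ℝ} (ha : 0 < a) (hab : a < b)
    (hb : b ≤ Real.pi / 2) :
    (b - a) / Real.sin b ≤ Real.log (Real.tan (b / 2)) - Real.log (Real.tan (a / 2)) := by
  have hder : ∀ x, 0 < x → x ≤ Real.pi / 2 →
      HasDerivAt (fun y => Real.log (Real.tan (y / 2))) (1 / Real.sin x) x := by
    intro x hx hx'
    have hpi := Real.pi_pos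
    have hs : 0 < Real.sin (x / 2) := Real.sin_pos_of_pos_of_lt_pi (by linarith) (by linarith)
    have hc : 0 < Real.cos (x / 2) := Real.cos_pos_of_mem_Ioo ⟨by linarith, by linarith⟩
    have ht : 0 < Real.tan (x / 2) := by rw [Real.tan_eq_sin_div_cos]; positivity
    have h : HasDerivAt (fun y => Real.tan (y / 2)) (1 / Real.cos (x / 2) ^ 2 * (1 / 2)) x :=
      HasDerivAt.comp x (Real.hasDerivAt_tan hc.ne') ((hasDerivAt_id x).div_const 2)
    refine (h.log ht.ne').congr_deriv ?_
    have hsin : Real.sin x = 2 * Real.sin (x / 2) * Real.cos (x / 2) := by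
      rw [← Real.sin_two_mul]; congr 1; ring
    rw [hsin, Real.tan_eq_sin_div_cos]
    field_simp
  obtain ⟨c, ⟨hac, hcb⟩, hc⟩ := exists_hasDerivAt_eq_slope
    (fun y => Real.log (Real.tan (y / 2))) (fun x => 1 / Real.sin x) hab
    (fun x hx => (hder x (by linarith [hx.1]) (by linarith [hx.2])).continuousAt.continuousWithinAt)
    (fun x hx => hder x (by linarith [hx.1]) (by linarith [hx.2]))
  have hba : 0 < b - a := by linarith
  have hsc : 0 < Real.sin c := Real.sin_pos_of_pos_of_lt_pi (by linarith) (by linarith)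
  have hle : Real.sin c ≤ Real.sin b :=
    Real.sin_le_sin_of_le_of_le_pi_div_two (by linarith) hb hcb.le
  rw [eq_div_iff hba.ne'] at hc
  rw [← hc, div_eq_mul_one_div, mul_comm]
  gcongr

/-- The sum of the reciprocal sines at the points `π k / (2N+1)`, `1 ≤ k ≤ n + 1`, is bounded by the
first term plus an integral. -/
theorem sum_one_div_sin_le_log_tan (N n : ℕ) (hn : n + 1 ≤ N) :
    ∑ k ∈ Finset.range (n + 1), 1 / Real.sin (Real.pi * ((k : ℝ) + 1) / (2 * (N : ℝ) + 1)) ≤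
      (2 * (N : ℝ) + 1) / 2 + (2 * (N : ℝ) + 1) / Real.pi *
        (Real.log (Real.tan (Real.pi * ((n : ℝ) + 1) / (2 * (N : ℝ) + 1) / 2)) -
          Real.log (Real.tan (Real.pi / (2 * (N : ℝ) + 1) / 2))) := by
  have hpi := Real.pi_pos
  have hK : (0 : ℝ) < 2 * (N : ℝ) + 1 := by positivity
  induction n with
  | zero =>
    have hN : (1 : ℝ) ≤ N := by exact_mod_cast hn
    have h := Real.mul_le_sin (x := Real.pi / (2 * (N : ℝ) + 1)) (by positivity)
      (by gcongr; linarith)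
    have h2 : 2 / Real.pi * (Real.pi / (2 * (N : ℝ) + 1)) = 2 / (2 * (N : ℝ) + 1) := by
      field_simp
    rw [h2] at h
    have := one_div_le_one_div_of_le (by positivity) h
    rw [one_div_div] at this
    simpa using this
  | succ n ih =>
    have hN : (n : ℝ) + 1 + 1 ≤ N := by exact_mod_cast hn
    have h := sub_div_sin_le_log_tan_sub (a := Real.pi * ((n : ℝ) + 1) / (2 * (N : ℝ) + 1))
      (b := Real.pi * ((n : ℝ) + 1 + 1) / (2 * (N : ℝ) + 1)) (by positivity)
      (by gcongr; linarith) (by rw [div_le_div_iff₀ hK two_pos]; nlinarith)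
    have h3 : Real.pi * ((n : ℝ) + 1 + 1) / (2 * (N : ℝ) + 1) -
        Real.pi * ((n : ℝ) + 1) / (2 * (N : ℝ) + 1) = Real.pi / (2 * (N : ℝ) + 1) := by ring
    rw [h3] at h
    have h4 := mul_le_mul_of_nonneg_left h (show 0 ≤ (2 * (N : ℝ) + 1) / Real.pi by positivity)
    have h5 : ∀ s : ℝ, (2 * (N : ℝ) + 1) / Real.pi * (Real.pi / (2 * (N : ℝ) + 1) / s) =
        1 / s := by intro s; field_simp
    rw [h5] at h4
    rw [Finset.sum_range_succ]
    push_cast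
    have := ih (by omega)
    linarith

theorem sum_one_div_sin_le (N : ℕ) (hN : 1 ≤ N) :
    ∑ k ∈ Finset.range N, 1 / Real.sin (Real.pi * ((k : ℝ) + 1) / (2 * (N : ℝ) + 1)) ≤
      (2 * (N : ℝ) + 1) *
        (1 / Real.pi * Real.log ((4 * (N : ℝ) + 2) / Real.pi) + 1 / 2) := by
  obtain ⟨n, rfl⟩ : ∃ n, N = n + 1 := ⟨N - 1, by omega⟩
  have hpi := Real.pi_pos
  refine (sum_one_div_sin_le_log_tan (n + 1) n le_rfl).trans ?_
  push_cast
  set K : ℝ := 2 * ((n : ℝ) + 1) + 1 with hKdef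
  have hn : (0 : ℝ) ≤ n := n.cast_nonneg
  have hK : 0 < K := by positivity
  have hlast : Real.log (Real.tan (Real.pi * ((n : ℝ) + 1) / K / 2)) ≤ 0 := by
    have hx : Real.pi * ((n : ℝ) + 1) / K / 2 < Real.pi / 4 := by
      rw [div_div, div_lt_div_iff₀ (by positivity) (by norm_num)]
      nlinarith
    refine Real.log_nonpos (Real.tan_nonneg_of_nonneg_of_le_pi_div_two (by positivity)
      (by linarith)) ?_
    have hx0 : 0 ≤ Real.pi * ((n : ℝ) + 1) / K / 2 := by positivity
    have htan := Real.tan_lt_tan_of_lt_of_lt_pi_div_two (by linarith) (by linarith) hx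
    rw [Real.tan_pi_div_four] at htan
    exact htan.le
  have hfirst : Real.log (Real.pi / K / 2) ≤ Real.log (Real.tan (Real.pi / K / 2)) := by
    refine Real.log_le_log (by positivity) (Real.le_tan (by positivity) ?_)
    rw [div_div, div_lt_div_iff₀ (by positivity) (by norm_num)]
    nlinarith
  have hlog : Real.log (Real.pi / K / 2) = -Real.log ((4 * ((n : ℝ) + 1) + 2) / Real.pi) := by
    rw [← Real.log_inv, inv_div, div_div]
    congr 2
    rw [hKdef]; ring
  rw [hlog] at hfirst
  calc _ ≤ K / 2 + K / Real.pi * Real.log ((4 * ((n : ℝ) + 1) + 2) / Real.pi) := by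
        gcongr
        linarith
    _ = _ := by ring

theorem sum_abs_fourierKer (N : ℕ) (l : ℝ) (hl : 0 < l) (p : ℤ) :
    ∑ m ∈ Finset.Icc (-(N : ℤ)) N, |fourierKer N l (p - m)| =
      2 * Real.pi / l *
        ∑ k ∈ Finset.range N, 1 / Real.sin (Real.pi * ((k : ℝ) + 1) / (2 * (N : ℝ) + 1)) := by
  set F : ℤ → ℝ := fun r => if r = 0 then 0 else
    Real.pi / (l * |Real.sin (Real.pi * (r : ℝ) / (2 * (N : ℝ) + 1))|) with hF
  set red : ℤ → ℤ := fun m => (p - m + N) % (2 * (N : ℤ) + 1) - N with hred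
  have hK : (0 : ℤ) < 2 * (N : ℤ) + 1 := by positivity
  have hmaps : ∀ m ∈ Finset.Icc (-(N : ℤ)) N, red m ∈ Finset.Icc (-(N : ℤ)) N := by
    intro m _
    have h1 := Int.emod_nonneg (p - m + N) hK.ne'
    have h2 := Int.emod_lt_of_pos (p - m + N) hK
    simp only [hred, Finset.mem_Icc]
    omega
  have hinv : ∀ m ∈ Finset.Icc (-(N : ℤ)) N, red (red m) = m := by
    intro m hm
    rw [Finset.mem_Icc] at hm
    have h := Int.emod_add_mul_ediv (p - m + N) (2 * (N : ℤ) + 1)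
    simp only [hred]
    have h2 : p - ((p - m + N) % (2 * (N : ℤ) + 1) - N) + N =
        m + N + (2 * (N : ℤ) + 1) * ((p - m + N) / (2 * (N : ℤ) + 1)) := by linarith
    rw [h2, Int.add_mul_emod_self_left, Int.emod_eq_of_lt (by omega) (by omega)]
    ring
  have habs : ∀ m, |fourierKer N l (p - m)| = F (red m) := by
    intro m
    simp only [fourierKer, hF, hred]
    split_ifs
    · simp
    · rw [abs_div, abs_mul, abs_mul, abs_zpow, abs_neg, abs_one, one_zpow, mul_one,
        abs_of_pos Real.pi_pos, abs_of_pos hl]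
  have heven : F.Even := by
    intro r
    simp [hF, neg_div, Real.sin_neg]
  rw [Finset.sum_nbij' (t := Finset.Icc (-(N : ℤ)) N) (g := F) red red hmaps hmaps hinv hinv
    (fun m _ => habs m), Finset.sum_Icc_of_even_eq_range heven, Finset.sum_range_succ',
    nsmul_eq_mul, Nat.cast_ofNat, Nat.cast_zero]
  have h0 : F 0 = 0 := by simp [hF]
  rw [h0, add_zero, sub_zero, Finset.mul_sum, Finset.mul_sum]
  refine Finset.sum_congr rfl fun k hk => ?_
  have hkN : (k : ℝ) + 1 ≤ N := by exact_mod_cast Finset.mem_range.mp hk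
  have hs : 0 < Real.sin (Real.pi * ((k : ℝ) + 1) / (2 * (N : ℝ) + 1)) := by
    have hpi := Real.pi_pos
    refine Real.sin_pos_of_pos_of_lt_pi (by positivity) ?_
    rw [div_lt_iff₀ (by positivity)]
    have hk0 : (0 : ℝ) ≤ k := k.cast_nonneg
    nlinarith
  have hne : ((k + 1 : ℕ) : ℤ) ≠ 0 := by positivity
  simp only [hF, if_neg hne]
  push_cast
  rw [abs_of_pos hs]
  field_simp

theorem mul_log_div_pi_le_mul_log {x : ℝ} (hx : 4 ≤ x) :
    2 * Real.pi * ((2 * x + 1) * (1 / Real.pi * Real.log ((4 * x + 2) / Real.pi) + 1 / 2)) ≤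
      48 * x * Real.log x := by
  have hpi := Real.pi_pos
  have hpi3 := Real.pi_gt_three
  have hpi4 := Real.pi_lt_four
  have hL : 1 ≤ Real.log x := by
    rw [Real.le_log_iff_exp_le (by linarith)]
    linarith [Real.exp_one_lt_three]
  have hlog : Real.log ((4 * x + 2) / Real.pi) ≤ 2 * Real.log x := by
    rw [← Real.log_rpow (by linarith), Real.rpow_two]
    refine Real.log_le_log (by positivity) ?_
    rw [div_le_iff₀ hpi]
    nlinarith
  calc _ = (2 * x + 1) * (2 * Real.log ((4 * x + 2) / Real.pi) + Real.pi) := by field_simp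
    _ ≤ (2 * x + 1) * (2 * (2 * Real.log x) + 4 * Real.log x) := by
        gcongr
        linarith
    _ ≤ _ := by nlinarith

/-- For `N ≥ 1`, `l > 0` and `u ∈ ℂ^{[-N..N]^d}` with `‖u‖_∞ ≤ M` on
the grid, the Fourier derivative
`(∂̃_j u)[n] = ∑_{m=-N}^N u[n_1,…,m,…,n_d] a[n_j - m]` satisfies
`‖∂̃_j u‖_∞ ≤ (2π/l) ‖u‖_∞ (2N+1) [ (1/π) ln((4N+2)/π) + 1/2 ]`, and moreover if
`N > 3` then `‖∂̃_j u‖_∞ ≤ (48/l) ‖u‖_∞ N ln N`. -/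
theorem fourier_deriv_sup_bound {d : ℕ} (N : ℕ) (hN : 1 ≤ N) (l : ℝ) (hl : 0 < l)
    (u : (Fin d → ℤ) → ℂ) (j : Fin d) (M : ℝ)
    (hM : ∀ n : Fin d → ℤ, (∀ i, n i ∈ Finset.Icc (-(N : ℤ)) N) → ‖u n‖ ≤ M)
    (n : Fin d → ℤ) (hn : ∀ i, n i ∈ Finset.Icc (-(N : ℤ)) N) :
    ‖∑ m ∈ Finset.Icc (-(N : ℤ)) N,
        u (Function.update n j m) * (fourierKer N l (n j - m) : ℂ)‖
      ≤ 2 * Real.pi / l * M * (2 * (N : ℝ) + 1) *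
          (1 / Real.pi * Real.log ((4 * (N : ℝ) + 2) / Real.pi) + 1 / 2) ∧
    (3 < N →
      ‖∑ m ∈ Finset.Icc (-(N : ℤ)) N,
          u (Function.update n j m) * (fourierKer N l (n j - m) : ℂ)‖
        ≤ 48 / l * M * N * Real.log N) := by
  have hM0 : 0 ≤ M := (norm_nonneg _).trans (hM n hn)
  have hmain : ‖∑ m ∈ Finset.Icc (-(N : ℤ)) N,
        u (Function.update n j m) * (fourierKer N l (n j - m) : ℂ)‖ ≤
      M * (2 * Real.pi / l * ((2 * (N : ℝ) + 1) *
          (1 / Real.pi * Real.log ((4 * (N : ℝ) + 2) / Real.pi) + 1 / 2))) := by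
    have hpi := Real.pi_pos
    calc _ ≤ ∑ m ∈ Finset.Icc (-(N : ℤ)) N, M * |fourierKer N l (n j - m)| := by
          refine norm_sum_le_of_le _ fun m hm => ?_
          rw [norm_mul, Complex.norm_real, Real.norm_eq_abs]
          gcongr
          refine hM _ fun i => ?_
          rcases eq_or_ne i j with rfl | hij
          · simpa using hm
          · simpa [Function.update_of_ne hij] using hn i
      _ ≤ _ := by
          rw [← Finset.mul_sum, sum_abs_fourierKer N l hl]
          gcongr
          exact sum_one_div_sin_le N hN
  refine ⟨hmain.trans_eq (by ring), fun h3 => hmain.trans ?_⟩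
  have h := mul_log_div_pi_le_mul_log (x := N) (by exact_mod_cast h3)
  calc _ = M / l * (2 * Real.pi * ((2 * (N : ℝ) + 1) *
          (1 / Real.pi * Real.log ((4 * (N : ℝ) + 2) / Real.pi) + 1 / 2))) := by ring
    _ ≤ M / l * (48 * N * Real.log N) := by gcongr
    _ = _ := by ring
end

section
/- Let f : ℝ^d → ℝ be a coordinate function of the output of a depth-D fully-connected neural network with sigmoid activations: g^{(0)}(x) = x, and g^{(k)} = σ( W^{(k)} g^{(k-1)} + b^{(k)} ) applied componentwise for k = 1, …, D, where σ(t) = 1/(1+e^{-t}), W^{(k)} are real weight matrices and b^{(k)} real bias vectors, and f is any component of g^{(D)}. Then f ∈ A_1(1, ã) where ã ≤ 2^D · exp( ∑_{k=1}^{D} ( 2‖W^{(k)}‖_∞ + ‖b^{(k)}‖_∞ ) ); that is, for every multi-index α, sup_{x ∈ (-1,1)^d} |D^α f(x)| ≤ ã^{|α|} · α! with ã as above. -/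
/-- `f ∈ A_U(C,a)`: `f` is smooth on `U` and
`sup_{x ∈ U} |D^α f(x)| ≤ C · a^{|α|} · α!` for every multi-index `α`. -/
def MemA {d : ℕ} (U : Set (Fin d → ℝ)) (C a : ℝ) (f : (Fin d → ℝ) → ℝ) : Prop :=
  ContDiffOn ℝ (⊤ : ℕ∞) f U ∧
    ∀ (α : Fin d → ℕ), ∀ x ∈ U,
      |mderiv α f x| ≤ C * a ^ (∑ i, α i) * ∏ i, (Nat.factorial (α i) : ℝ)

/-- The sigmoid activation function `σ(t) = 1/(1 + e^{-t})`. -/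
noncomputable def sigmoid (t : ℝ) : ℝ := 1 / (1 + Real.exp (-t))

/-- The output `g^{(k)}` of the `k`-th layer of a fully-connected neural network with
sigmoid activations, layer widths `w`, weights `W` and biases `b`:
`g^{(0)}(x) = x` and `g^{(k)} = σ(W^{(k)} g^{(k-1)} + b^{(k)})` componentwise. -/
noncomputable def netLayer (w : ℕ → ℕ)
    (W : ∀ k : ℕ, Matrix (Fin (w (k + 1))) (Fin (w k)) ℝ)
    (b : ∀ k : ℕ, Fin (w (k + 1)) → ℝ) :
    (k : ℕ) → (Fin (w 0) → ℝ) → Fin (w k) → ℝ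
  | 0 => fun x => x
  | (k + 1) => fun x i => sigmoid ((W k).mulVec (netLayer w W b k x) i + b k i)

/-- The complex partial derivative `∂F/∂z_i` of a function `F : ℂ^d → ℂ`. -/
noncomputable def cpderiv {d : ℕ} (i : Fin d) (F : (Fin d → ℂ) → ℂ) : (Fin d → ℂ) → ℂ :=
  fun z => fderiv ℂ F z (Pi.single i 1)

/-- The tube `{z : |Im z_j| < ρ for all j}` around `ℝ^d` in `ℂ^d`. -/
def tube (d : ℕ) (ρ : ℝ) : Set (Fin d → ℂ) := {z | ∀ j, |(z j).im| < ρ}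

theorem AnalyticOnNhd.cpderiv {d : ℕ} {U : Set (Fin d → ℂ)} {F : (Fin d → ℂ) → ℂ}
    (hF : AnalyticOnNhd ℂ F U) (i : Fin d) : AnalyticOnNhd ℂ (cpderiv i F) U := fun z hz =>
  ((ContinuousLinearMap.apply ℂ ℂ (Pi.single i 1 : Fin d → ℂ)).analyticAt _).comp
    (hF.fderiv z hz)

theorem AnalyticOnNhd.iterate_cpderiv {d : ℕ} {U : Set (Fin d → ℂ)} {F : (Fin d → ℂ) → ℂ}
    (hF : AnalyticOnNhd ℂ F U) (i : Fin d) (n : ℕ) :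
    AnalyticOnNhd ℂ ((_root_.cpderiv i)^[n] F) U := by
  induction n with
  | zero => exact hF
  | succ n ih => rw [Function.iterate_succ_apply']; exact ih.cpderiv i

theorem AnalyticOnNhd.foldr_cpderiv {d : ℕ} {U : Set (Fin d → ℂ)} {F : (Fin d → ℂ) → ℂ}
    (hF : AnalyticOnNhd ℂ F U) (α : Fin d → ℕ) (l : List (Fin d)) :
    AnalyticOnNhd ℂ (l.foldr (fun i G => (_root_.cpderiv i)^[α i] G) F) U := by
  induction l with
  | nil => exact hF
  | cons i l ih => exact ih.iterate_cpderiv i (α i)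

/-- Real partial derivatives of the real part of an analytic function are real parts of its complex
partial derivatives. -/
theorem pderiv_re {d : ℕ} {F : (Fin d → ℂ) → ℂ}
    (hF : ∀ x : Fin d → ℝ, AnalyticAt ℂ F (fun j => (x j : ℂ))) (i : Fin d) :
    pderiv i (fun x => (F fun j => (x j : ℂ)).re) =
      fun x => (cpderiv i F fun j => (x j : ℂ)).re := by
  funext x
  let L : (Fin d → ℝ) →L[ℝ] (Fin d → ℂ) :=
    ContinuousLinearMap.pi fun j => Complex.ofRealCLM.comp (ContinuousLinearMap.proj j)
  have hL : HasFDerivAt (fun y : Fin d → ℝ => fun j => (y j : ℂ)) L x := L.hasFDerivAt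
  have h := ((hF x).differentiableAt.hasFDerivAt.restrictScalars ℝ).comp x hL
  have h2 := (Complex.reCLM.hasFDerivAt.comp x h).fderiv
  have hs : L (Pi.single i 1) = Pi.single i 1 := by
    funext j
    rcases eq_or_ne j i with rfl | hj <;> simp [L, *]
  simp only [pderiv, cpderiv]
  rw [← hs]
  exact congrArg (fun T : (Fin d → ℝ) →L[ℝ] ℝ => T (Pi.single i 1)) h2

theorem mderiv_re {d : ℕ} {ρ : ℝ} (hρ : 0 < ρ) {F : (Fin d → ℂ) → ℂ}
    (hF : AnalyticOnNhd ℂ F (tube d ρ)) (α : Fin d → ℕ) :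
    mderiv α (fun x => (F fun j => (x j : ℂ)).re) = fun x =>
      ((List.finRange d).foldr (fun i G => (cpderiv i)^[α i] G) F fun j => (x j : ℂ)).re := by
  have hreal (x : Fin d → ℝ) : (fun j => (x j : ℂ)) ∈ tube d ρ := fun j => by simpa using hρ
  unfold mderiv
  induction List.finRange d with
  | nil => rfl
  | cons i l ih =>
    simp only [List.foldr_cons, ih]
    induction α i with
    | zero => rfl
    | succ n ihn =>
      simp only [Function.iterate_succ_apply', ihn]
      exact pderiv_re
        (fun x => (hF.foldr_cpderiv α l).iterate_cpderiv i n _ (hreal x)) i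

theorem update_mem_tube {d : ℕ} {ρ R : ℝ} (hR : R < ρ) {z : Fin d → ℂ} (hz : z ∈ tube d ρ)
    {i : Fin d} (hi : (z i).im = 0) {t : ℂ} (ht : t ∈ Metric.closedBall (z i) R) :
    Function.update z i t ∈ tube d ρ := by
  intro j
  rcases eq_or_ne j i with rfl | hj
  · have h1 := Complex.abs_im_le_norm (t - z j)
    rw [Complex.sub_im, hi, sub_zero] at h1
    rw [Function.update_self]
    rw [Metric.mem_closedBall, dist_eq_norm] at ht
    linarith
  · simpa [hj] using hz j

theorem hasDerivAt_update_cpderiv {d : ℕ} {F : (Fin d → ℂ) → ℂ} {z : Fin d → ℂ} {i : Fin d}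
    {t : ℂ} (hF : AnalyticAt ℂ F (Function.update z i t)) :
    HasDerivAt (fun s => F (Function.update z i s)) (cpderiv i F (Function.update z i t)) t :=
  hF.differentiableAt.hasFDerivAt.comp_hasDerivAt t (hasDerivAt_update z i t)

theorem isOpen_tube (d : ℕ) (ρ : ℝ) : IsOpen (tube d ρ) := by
  simp only [tube, Set.ofPred_forall]
  exact isOpen_iInter_of_finite fun j => isOpen_lt (by fun_prop) continuous_const

theorem iteratedDeriv_update {d : ℕ} {U : Set (Fin d → ℂ)} (hU : IsOpen U)
    {F : (Fin d → ℂ) → ℂ} (hF : AnalyticOnNhd ℂ F U) (z : Fin d → ℂ) (i : Fin d) (n : ℕ) {t : ℂ}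
    (ht : Function.update z i t ∈ U) :
    iteratedDeriv n (fun s => F (Function.update z i s)) t =
      (cpderiv i)^[n] F (Function.update z i t) := by
  induction n generalizing t with
  | zero => simp
  | succ n ih =>
    have hc : Continuous fun s : ℂ => Function.update z i s := by fun_prop
    have he : iteratedDeriv n (fun s => F (Function.update z i s)) =ᶠ[nhds t]
        fun s => (cpderiv i)^[n] F (Function.update z i s) := by
      filter_upwards [hc.continuousAt.preimage_mem_nhds (hU.mem_nhds ht)] with s hs
      exact ih hs
    rw [iteratedDeriv_succ, he.deriv_eq, Function.iterate_succ_apply']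
    exact (hasDerivAt_update_cpderiv (hF.iterate_cpderiv i n _ ht)).deriv

/-- Cauchy's estimate in a single variable. -/
theorem norm_iterate_cpderiv_le {d : ℕ} {ρ R C : ℝ} (hR0 : 0 < R) (hR : R < ρ)
    {F : (Fin d → ℂ) → ℂ} (hF : AnalyticOnNhd ℂ F (tube d ρ)) {z : Fin d → ℂ}
    (hz : z ∈ tube d ρ) {i : Fin d} (hi : (z i).im = 0) (n : ℕ)
    (hC : ∀ t ∈ Metric.sphere (z i) R, ‖F (Function.update z i t)‖ ≤ C) :
    ‖(cpderiv i)^[n] F z‖ ≤ n.factorial * C / R ^ n := by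
  have hd : DifferentiableOn ℂ (fun s => F (Function.update z i s))
      (Metric.closedBall (z i) R) := fun t ht =>
    (hasDerivAt_update_cpderiv (hF _ (update_mem_tube hR hz hi ht))).differentiableAt
      |>.differentiableWithinAt
  have h := Complex.norm_iteratedDeriv_le_of_forall_mem_sphere_norm_le n hR0
    (hd.diffContOnCl_ball subset_rfl) hC
  rwa [iteratedDeriv_update (isOpen_tube d ρ) hF z i n (by simpa using hz),
    Function.update_eq_self] at h

/-- Cauchy's estimate for a list of distinct variables. -/
theorem norm_foldr_cpderiv_le {d : ℕ} {ρ R C : ℝ} (hR0 : 0 < R) (hR : R < ρ)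
    {F : (Fin d → ℂ) → ℂ} (hF : AnalyticOnNhd ℂ F (tube d ρ))
    (hC : ∀ z ∈ tube d ρ, ‖F z‖ ≤ C) (α : Fin d → ℕ) {l : List (Fin d)} (hl : l.Nodup)
    {z : Fin d → ℂ} (hz : z ∈ tube d ρ) (hzl : ∀ j ∈ l, (z j).im = 0) :
    ‖l.foldr (fun i G => (cpderiv i)^[α i] G) F z‖ ≤
      C * (l.map fun j => ((α j).factorial : ℝ) / R ^ α j).prod := by
  induction l generalizing z with
  | nil => simpa using hC z hz
  | cons i l ih =>
    obtain ⟨hil, hl⟩ := List.nodup_cons.mp hl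
    have h := norm_iterate_cpderiv_le hR0 hR (hF.foldr_cpderiv α l) hz (hzl i (by simp)) (α i)
      fun t ht => ih hl
        (update_mem_tube hR hz (hzl i (by simp)) (Metric.sphere_subset_closedBall ht))
        fun j hj => by
          have hji : j ≠ i := fun h => hil (h ▸ hj)
          simpa [hji] using hzl j (by simp [hj])
    refine h.trans_eq ?_
    rw [List.map_cons, List.prod_cons]
    ring

theorem abs_mderiv_re_le {d : ℕ} {ρ R C : ℝ} (hR0 : 0 < R) (hR : R < ρ)
    {F : (Fin d → ℂ) → ℂ} (hF : AnalyticOnNhd ℂ F (tube d ρ))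
    (hC : ∀ z ∈ tube d ρ, ‖F z‖ ≤ C) (α : Fin d → ℕ) (x : Fin d → ℝ) :
    |mderiv α (fun x => (F fun j => (x j : ℂ)).re) x| ≤
      C * R⁻¹ ^ (∑ i, α i) * ∏ i, ((α i).factorial : ℝ) := by
  rw [mderiv_re (hR0.trans hR) hF]
  refine (Complex.abs_re_le_norm _).trans <| (norm_foldr_cpderiv_le hR0 hR hF hC α
    (List.nodup_finRange d) (fun j => by simpa using hR0.trans hR) (by simp)).trans_eq ?_
  rw [← Finset.prod_pow_eq_pow_sum, mul_assoc, ← Finset.prod_mul_distrib, ← List.ofFn_eq_map,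
    List.prod_ofFn]
  congr 1
  refine Finset.prod_congr rfl fun i _ => ?_
  rw [inv_pow]
  ring

/-- The complex sigmoid function. -/
noncomputable def csigmoid (u : ℂ) : ℂ := 1 / (1 + Complex.exp (-u))

theorem csigmoid_ofReal (t : ℝ) : csigmoid t = (sigmoid t : ℂ) := by
  simp [csigmoid, sigmoid]

theorem one_le_re_one_add_exp_neg {u : ℂ} (hu : |u.im| ≤ 1) :
    1 ≤ (1 + Complex.exp (-u)).re := by
  have hc : 0 < Real.cos u.im := Real.cos_pos_of_le_one hu
  simp only [Complex.add_re, Complex.one_re, Complex.exp_re, Complex.neg_re, Complex.neg_im,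
    Real.cos_neg]
  have := mul_pos (Real.exp_pos (-u.re)) hc
  linarith

theorem one_add_exp_neg_ne_zero {u : ℂ} (hu : |u.im| ≤ 1) : 1 + Complex.exp (-u) ≠ 0 := by
  intro h
  have := one_le_re_one_add_exp_neg hu
  rw [h, Complex.zero_re] at this
  linarith

theorem analyticAt_csigmoid {u : ℂ} (hu : |u.im| ≤ 1) : AnalyticAt ℂ csigmoid u :=
  analyticAt_const.div (analyticAt_const.add analyticAt_id.neg.cexp) (one_add_exp_neg_ne_zero hu)

theorem norm_csigmoid_le_one {u : ℂ} (hu : |u.im| ≤ 1) : ‖csigmoid u‖ ≤ 1 := by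
  rw [csigmoid, norm_div, norm_one]
  exact div_le_one_of_le₀
    ((one_le_re_one_add_exp_neg hu).trans (Complex.re_le_norm _)) (norm_nonneg _)

theorem abs_im_csigmoid_le {u : ℂ} (hu : |u.im| ≤ 1) : |(csigmoid u).im| ≤ |u.im| := by
  have hc : 0 < Real.cos u.im := Real.cos_pos_of_le_one hu
  have hE := Real.exp_pos (-u.re)
  have hs := Real.abs_sin_le_abs (x := u.im)
  have hsc := Real.sin_sq_add_cos_sq u.im
  rw [csigmoid, one_div, Complex.inv_im, Complex.normSq_apply]
  simp only [Complex.add_re, Complex.one_re, Complex.exp_re, Complex.neg_re, Complex.neg_im,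
    Complex.add_im, Complex.one_im, Complex.exp_im, Real.cos_neg, Real.sin_neg]
  generalize Real.exp (-u.re) = E at *
  have hden : E ≤ (1 + E * Real.cos u.im) * (1 + E * Real.cos u.im) +
      (0 + E * -Real.sin u.im) * (0 + E * -Real.sin u.im) := by
    have : (1 + E * Real.cos u.im) * (1 + E * Real.cos u.im) +
      (0 + E * -Real.sin u.im) * (0 + E * -Real.sin u.im) =
        1 + 2 * (E * Real.cos u.im) + E ^ 2 := by linear_combination E ^ 2 * hsc
    nlinarith [mul_pos hE hc, sq_nonneg (E - 1)]
  rw [abs_div, abs_of_pos (hE.trans_le hden), div_le_iff₀ (hE.trans_le hden)]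
  calc |-(0 + E * -Real.sin u.im)| = |Real.sin u.im| * E := by
        rw [zero_add, mul_neg, neg_neg, abs_mul, abs_of_pos hE, mul_comm]
    _ ≤ _ := mul_le_mul hs hden hE.le (abs_nonneg _)

/-- The holomorphic extension of `netLayer`. -/
noncomputable def cnetLayer (w : ℕ → ℕ)
    (W : ∀ k : ℕ, Matrix (Fin (w (k + 1))) (Fin (w k)) ℝ)
    (b : ∀ k : ℕ, Fin (w (k + 1)) → ℝ) :
    (k : ℕ) → (Fin (w 0) → ℂ) → Fin (w k) → ℂ
  | 0 => fun z => z
  | (k + 1) => fun z i => csigmoid (∑ j, (W k i j : ℂ) * cnetLayer w W b k z j + (b k i : ℂ))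

section Network

variable {w : ℕ → ℕ} {W : ∀ k : ℕ, Matrix (Fin (w (k + 1))) (Fin (w k)) ℝ}
  {b : ∀ k : ℕ, Fin (w (k + 1)) → ℝ}

theorem cnetLayer_ofReal (k : ℕ) (x : Fin (w 0) → ℝ) (i : Fin (w k)) :
    cnetLayer w W b k (fun j => (x j : ℂ)) i = (netLayer w W b k x i : ℂ) := by
  induction k with
  | zero => rfl
  | succ k ih =>
    simp only [cnetLayer, netLayer, ih, ← csigmoid_ofReal, Matrix.mulVec, dotProduct]
    push_cast
    rfl

theorem contDiff_netLayer (k : ℕ) (i : Fin (w k)) :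
    ContDiff ℝ (⊤ : ℕ∞) (fun x => netLayer w W b k x i) := by
  induction k with
  | zero => exact contDiff_apply ℝ ℝ i
  | succ k ih =>
    have hσ : ContDiff ℝ (⊤ : ℕ∞) sigmoid :=
      contDiff_const.div (contDiff_const.add contDiff_neg.exp) fun t => by positivity
    have hsum : ContDiff ℝ (⊤ : ℕ∞) fun x => ∑ j, W k i j * netLayer w W b k x j :=
      ContDiff.sum fun j _ => contDiff_const.mul (ih j)
    exact hσ.comp (hsum.add contDiff_const)

theorem abs_im_affine_le (k : ℕ) (i : Fin (w (k + 1))) {g : Fin (w k) → ℂ} {B : ℝ} (hB : 0 ≤ B)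
    (hg : ∀ j, |(g j).im| ≤ B) :
    |(∑ j, (W k i j : ℂ) * g j + (b k i : ℂ)).im| ≤
      (⨆ r : Fin (w (k + 1)), ∑ j, |W k r j|) * B := by
  have h1 : (∑ j, (W k i j : ℂ) * g j + (b k i : ℂ)).im = ∑ j, W k i j * (g j).im := by
    simp
  rw [h1]
  calc |∑ j, W k i j * (g j).im| ≤ ∑ j, |W k i j| * B :=
        (Finset.abs_sum_le_sum_abs _ _).trans <| Finset.sum_le_sum fun j _ => by
          rw [abs_mul]
          exact mul_le_mul_of_nonneg_left (hg j) (abs_nonneg _)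
    _ = (∑ j, |W k i j|) * B := (Finset.sum_mul ..).symm
    _ ≤ _ := mul_le_mul_of_nonneg_right
        (le_ciSup (f := fun r => ∑ j, |W k r j|) (Set.finite_range _).bddAbove i) hB

/-- Suppose the imaginary parts of the inputs are so small that the bounds `ρ * P k` on the
imaginary parts at layers `k ≤ D` never exceed `1`. Then the network is analytic on the tube. -/
theorem analyticOnNhd_cnetLayer {D : ℕ} {ρ : ℝ} (hρ : 0 ≤ ρ) {P : ℕ → ℝ} (hP0 : 1 ≤ P 0)
    (hP : ∀ k, (⨆ r : Fin (w (k + 1)), ∑ j, |W k r j|) * P k ≤ P (k + 1))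
    (hP1 : ∀ k ≤ D, ρ * P k ≤ 1) (hPnonneg : ∀ k, 0 ≤ P k) {k : ℕ} (hk : k ≤ D) (i : Fin (w k)) :
    AnalyticOnNhd ℂ (fun z => cnetLayer w W b k z i) (tube (w 0) ρ) ∧
      (∀ z ∈ tube (w 0) ρ, |(cnetLayer w W b k z i).im| ≤ ρ * P k) ∧
      (k ≠ 0 → ∀ z ∈ tube (w 0) ρ, ‖cnetLayer w W b k z i‖ ≤ 1) := by
  induction k with
  | zero =>
    refine ⟨fun z _ => (ContinuousLinearMap.proj (R := ℂ) (φ := fun _ : Fin (w 0) => ℂ)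
      i).analyticAt z, fun z hz => (hz i).le.trans (le_mul_of_one_le_right hρ hP0), by simp⟩
  | succ k ih =>
    have ih := fun j => ih (by lia) j
    have him (z) (hz : z ∈ tube (w 0) ρ) :
        |(∑ j, (W k i j : ℂ) * cnetLayer w W b k z j + (b k i : ℂ)).im| ≤ ρ * P (k + 1) := by
      refine (abs_im_affine_le k i (mul_nonneg hρ (hPnonneg k))
        fun j => (ih j).2.1 z hz).trans ?_
      rw [mul_left_comm]
      exact mul_le_mul_of_nonneg_left (hP k) hρ
    have him1 (z) (hz : z ∈ tube (w 0) ρ) := (him z hz).trans (hP1 _ hk)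
    refine ⟨fun z hz => ?_, fun z hz => (abs_im_csigmoid_le (him1 z hz)).trans (him z hz),
      fun _ z hz => norm_csigmoid_le_one (him1 z hz)⟩
    refine (analyticAt_csigmoid (him1 z hz)).comp (f := fun z =>
      ∑ j, (W k i j : ℂ) * cnetLayer w W b k z j + (b k i : ℂ)) ?_
    exact (Finset.analyticAt_fun_sum _ fun j _ =>
      analyticAt_const.mul ((ih j).1 z hz)).add analyticAt_const

end Network

/-- Every derivative of a coordinate function is that function or a constant of modulus at most
one. -/
theorem mderiv_coord {d : ℕ} (i : Fin d) (α : Fin d → ℕ) :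
    mderiv α (fun x => x i) = (fun x => x i) ∨
      ∃ c : ℝ, |c| ≤ 1 ∧ mderiv α (fun x : Fin d → ℝ => x i) = fun _ => c := by
  have step (j : Fin d) (g : (Fin d → ℝ) → ℝ)
      (hg : g = (fun x => x i) ∨ ∃ c : ℝ, |c| ≤ 1 ∧ g = fun _ => c) :
      pderiv j g = (fun x => x i) ∨ ∃ c : ℝ, |c| ≤ 1 ∧ pderiv j g = fun _ => c := by
    right
    rcases hg with rfl | ⟨c, -, rfl⟩
    · refine ⟨(Pi.single j 1 : Fin d → ℝ) i, ?_, ?_⟩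
      · rcases eq_or_ne i j with rfl | h <;> simp [*]
      · funext x
        simp only [pderiv]
        rw [(hasFDerivAt_apply i x).fderiv]
        rfl
    · exact ⟨0, by simp, by funext x; simp [pderiv]⟩
  unfold mderiv
  induction List.finRange d with
  | nil => exact Or.inl rfl
  | cons j l ih =>
    rw [List.foldr_cons]
    induction α j with
    | zero => exact ih
    | succ n ihn => rw [Function.iterate_succ_apply']; exact step j _ ihn

theorem memA_coord {d : ℕ} (i : Fin d) :
    MemA (Set.univ.pi fun _ : Fin d => Set.Ioo (-1 : ℝ) 1) 1 1 (fun x => x i) := by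
  refine ⟨(contDiff_apply ℝ ℝ i).contDiffOn, fun α x hx => ?_⟩
  have h1 : |mderiv α (fun x => x i) x| ≤ 1 := by
    rcases mderiv_coord i α with h | ⟨c, hc, h⟩
    · rw [h]
      exact (abs_lt.mpr (hx i (Set.mem_univ i))).le
    · rw [h]
      exact hc
  have h2 : (1 : ℝ) ≤ ∏ i, ((α i).factorial : ℝ) := by
    exact_mod_cast Nat.one_le_iff_ne_zero.mpr
      (Finset.prod_ne_zero_iff.mpr fun i _ => Nat.factorial_ne_zero (α i))
  simpa using h1.trans h2

/-- Any output coordinate `f` of a depth-`D` fully-connected neural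
network with sigmoid activations lies in `A_1(1, ã)` with
`ã = 2^D exp(∑_{k=1}^D (2‖W^{(k)}‖_∞ + ‖b^{(k)}‖_∞))`, where `‖·‖_∞` is the maximum
absolute row sum for matrices and the maximum absolute entry for vectors. -/
theorem neural_net_memA (D : ℕ) (w : ℕ → ℕ)
    (W : ∀ k : ℕ, Matrix (Fin (w (k + 1))) (Fin (w k)) ℝ)
    (b : ∀ k : ℕ, Fin (w (k + 1)) → ℝ) (i : Fin (w D)) :
    MemA (Set.univ.pi fun _ : Fin (w 0) => Set.Ioo (-1 : ℝ) 1) 1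
      (2 ^ D * Real.exp (∑ k ∈ Finset.range D,
        (2 * (⨆ r : Fin (w (k + 1)), ∑ j, |W k r j|) +
          ⨆ r : Fin (w (k + 1)), |b k r|)))
      (fun x => netLayer w W b D x i) := by
  rcases Nat.eq_zero_or_pos D with rfl | hD
  · simpa [netLayer] using memA_coord i
  refine ⟨(contDiff_netLayer D i).contDiffOn, fun α x _ => ?_⟩
  set c : ℕ → ℝ := fun k => 2 * (⨆ r : Fin (w (k + 1)), ∑ j, |W k r j|) +
    ⨆ r : Fin (w (k + 1)), |b k r| with hc
  have hW (k) : 0 ≤ ⨆ r : Fin (w (k + 1)), ∑ j, |W k r j| :=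
    Real.iSup_nonneg fun r => Finset.sum_nonneg fun j _ => abs_nonneg _
  have hb (k) : 0 ≤ ⨆ r : Fin (w (k + 1)), |b k r| := Real.iSup_nonneg fun r => abs_nonneg _
  have hc0 (k) : 0 ≤ c k := by
    have := hW k
    have := hb k
    simp only [hc]
    positivity
  set S : ℕ → ℝ := fun n => ∑ k ∈ Finset.range n, c k with hS
  have hρ : 0 < Real.exp (-S D) := Real.exp_pos _
  obtain ⟨hF, -, hF1⟩ := analyticOnNhd_cnetLayer (W := W) (b := b) (D := D) hρ.le
    (P := fun k => Real.exp (S k)) (by simp [hS])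
    (fun k => by
      simp only [hS, Finset.sum_range_succ, Real.exp_add]
      rw [mul_comm]
      refine mul_le_mul_of_nonneg_left ?_ (Real.exp_pos _).le
      have h1 := Real.add_one_le_exp (c k)
      have h2 : c k = 2 * (⨆ r : Fin (w (k + 1)), ∑ j, |W k r j|) +
        ⨆ r : Fin (w (k + 1)), |b k r| := rfl
      have := hW k
      have := hb k
      linarith)
    (fun k hk => by
      rw [← Real.exp_add, Real.exp_le_one_iff]
      have : S k ≤ S D := Finset.sum_le_sum_of_subset_of_nonneg
        (Finset.range_mono hk) fun j _ _ => hc0 j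
      linarith)
    (fun k => (Real.exp_pos _).le) le_rfl i
  have h2 : (1 : ℝ) < 2 ^ D := one_lt_pow₀ (by norm_num) hD.ne'
  have h := abs_mderiv_re_le (R := (2 ^ D * Real.exp (S D))⁻¹) (by positivity)
    (by
      rw [mul_inv, ← Real.exp_neg]
      exact mul_lt_of_lt_one_left hρ (inv_lt_one_of_one_lt₀ h2))
    hF (hF1 hD.ne') α x
  simpa only [cnetLayer_ofReal, Complex.ofReal_re, inv_inv] using h
end
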